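/- The convolution of two log-concave probability density functions on ℝ^N is log-concave. -/

import Mathlib

open MeasureTheory Set

def LogConcave {N : ℕ} (f : (Fin N → ℝ) → ℝ) : Prop :=
  (∀ x, 0 ≤ f x) ∧
    ∀ x y θ, θ ∈ Set.Ioo (0 : ℝ) 1 →
      f x ^ θ * f y ^ (1 - θ) ≤ f (θ • x + (1 - θ) • y)

open scoped ENNReal Pointwise

theorem ENNReal.geom_mean_le_arith_mean2_weighted {θ : ℝ} (hθ : θ ∈ Ioo (0 : ℝ) 1) (a b : ℝ≥0∞) :
    a ^ θ * b ^ (1 - θ) ≤ ENNReal.ofReal θ * a + ENNReal.ofReal (1 - θ) * b := by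
  have h0 : 0 < θ := hθ.1
  have h1 : 0 < 1 - θ := sub_pos.2 hθ.2
  by_cases ha : a = ⊤
  · simp [ha, ENNReal.mul_top, h0]
  by_cases hb : b = ⊤
  · simp [hb, ENNReal.mul_top, hθ.2]
  lift a to NNReal using ha
  lift b to NNReal using hb
  rw [← ENNReal.coe_rpow_of_nonneg _ h0.le, ← ENNReal.coe_rpow_of_nonneg _ h1.le]
  have := NNReal.geom_mean_le_arith_mean2_weighted θ.toNNReal (1 - θ).toNNReal a b
    (by rw [← Real.toNNReal_add h0.le h1.le]; simp)
  rw [Real.coe_toNNReal _ h0.le, Real.coe_toNNReal _ h1.le] at this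
  change _ ≤ ((θ.toNNReal : ℝ≥0∞)) * a + (((1 - θ).toNNReal : ℝ≥0∞)) * b
  exact_mod_cast this

/-- The one-dimensional Brunn–Minkowski inequality for compact sets. -/
theorem IsCompact.volume_add_le_volume {K L C : Set ℝ} (hK : IsCompact K) (hL : IsCompact L)
    (hK0 : K.Nonempty) (hL0 : L.Nonempty) (hC : K + L ⊆ C) :
    volume K + volume L ≤ volume C := by
  obtain ⟨k, hk, hkmax⟩ := hK.exists_isGreatest hK0
  obtain ⟨l, hl, hlmin⟩ := hL.exists_isLeast hL0
  have hd : AEDisjoint volume ((fun x => l + x) '' K) ((fun x => k + x) '' L) := by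
    refine measure_mono_null (t := {k + l}) ?_ (by simp)
    rintro _ ⟨⟨x, hx, rfl⟩, ⟨y, hy, hxy⟩⟩
    have h1 := hkmax hx
    have h2 := hlmin hy
    simp only at hxy
    simp only [mem_singleton_iff]
    linarith
  calc volume K + volume L
      = volume ((fun x => l + x) '' K) + volume ((fun x => k + x) '' L) := by
        simp [measure_preimage_add]
    _ = volume (((fun x => l + x) '' K) ∪ ((fun x => k + x) '' L)) :=
        (measure_union₀ (hL.image (by fun_prop)).measurableSet.nullMeasurableSet hd).symm
    _ ≤ volume C := by
        refine measure_mono (union_subset ?_ ?_)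
        · rintro _ ⟨x, hx, rfl⟩
          exact hC ⟨x, hx, l, hl, add_comm _ _⟩
        · rintro _ ⟨x, hx, rfl⟩
          exact hC ⟨k, hk, x, hx, rfl⟩

/-- The one-dimensional Brunn–Minkowski inequality for measurable sets. -/
theorem MeasurableSet.volume_add_le_volume {A B C : Set ℝ} (hA : MeasurableSet A)
    (hB : MeasurableSet B) (hA0 : A.Nonempty) (hB0 : B.Nonempty) (hC : A + B ⊆ C) :
    volume A + volume B ≤ volume C := by
  obtain ⟨a, ha⟩ := hA0
  obtain ⟨b, hb⟩ := hB0
  have key : ∀ K, K ⊆ A ∧ IsCompact K → ∀ L, L ⊆ B ∧ IsCompact L →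
      volume K + volume L ≤ volume C := by
    rintro K ⟨hKA, hK⟩ L ⟨hLB, hL⟩
    refine le_trans (add_le_add (measure_mono (subset_insert a K))
      (measure_mono (subset_insert b L))) ?_
    exact (hK.insert a).volume_add_le_volume (hL.insert b) (insert_nonempty _ _)
      (insert_nonempty _ _)
      ((add_subset_add (insert_subset ha hKA) (insert_subset hb hLB)).trans hC)
  rw [hA.measure_eq_iSup_isCompact, hB.measure_eq_iSup_isCompact]
  simpa only [iSup_and] using ENNReal.biSup_add_biSup_le' (p := fun K => K ⊆ A ∧ IsCompact K)
    (q := fun L => L ⊆ B ∧ IsCompact L) ⟨∅, by simp⟩ ⟨∅, by simp⟩ key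

theorem lintegral_eq_setLIntegral_Ioo_meas_lt {α : Type*} [MeasurableSpace α] (μ : Measure α)
    {f : α → ℝ≥0∞} (hf : Measurable f) (hf1 : ∀ x, f x ≤ 1) :
    ∫⁻ x, f x ∂μ = ∫⁻ t in Ioo (0 : ℝ) 1, μ {x | ENNReal.ofReal t < f x} := by
  have hfin : ∀ x, f x ≠ ⊤ := fun x => ((hf1 x).trans_lt ENNReal.one_lt_top).ne
  have h := lintegral_eq_lintegral_meas_lt μ (f := fun x => (f x).toReal)
    (ae_of_all _ fun x => ENNReal.toReal_nonneg) hf.ennreal_toReal.aemeasurable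
  simp only [ENNReal.ofReal_toReal (hfin _)] at h
  rw [h, ← lintegral_indicator measurableSet_Ioi, ← lintegral_indicator measurableSet_Ioo]
  congr 1
  ext t
  by_cases h0 : 0 < t
  · by_cases h1 : t < 1
    · rw [indicator_of_mem (mem_Ioi.2 h0), indicator_of_mem (mem_Ioo.2 ⟨h0, h1⟩)]
      congr 1
      ext x
      exact (ENNReal.ofReal_lt_iff_lt_toReal h0.le (hfin x)).symm
    · rw [indicator_of_mem (mem_Ioi.2 h0), indicator_of_notMem (fun h => h1 h.2)]
      refine measure_mono_null (t := ∅) (fun x hx => h1 ?_) (by simp)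
      exact lt_of_lt_of_le hx (ENNReal.toReal_le_of_le_ofReal zero_le_one (by simpa using hf1 x))
  · rw [indicator_of_notMem (fun h => h0 (mem_Ioi.1 h)), indicator_of_notMem (fun h => h0 h.1)]

theorem antitone_meas_ofReal_lt {α : Type*} [MeasurableSpace α] (μ : Measure α) (f : α → ℝ≥0∞) :
    Antitone fun t : ℝ => μ {x | ENNReal.ofReal t < f x} :=
  fun _ _ hst => measure_mono fun _ hx => (ENNReal.ofReal_le_ofReal hst).trans_lt hx

theorem add_lintegral_le_lintegral_of_iSup_eq_one {θ : ℝ} (hθ : θ ∈ Ioo (0 : ℝ) 1)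
    {f g h : ℝ → ℝ≥0∞} (hf : Measurable f) (hg : Measurable g) (hh : Measurable h)
    (hf1 : ⨆ x, f x = 1) (hg1 : ⨆ x, g x = 1)
    (H : ∀ x y, f x ^ θ * g y ^ (1 - θ) ≤ h (θ * x + (1 - θ) * y)) :
    ENNReal.ofReal θ * (∫⁻ x, f x) + ENNReal.ofReal (1 - θ) * (∫⁻ x, g x) ≤ ∫⁻ x, h x := by
  have h0 : 0 < θ := hθ.1
  have h1 : 0 < 1 - θ := sub_pos.2 hθ.2
  rw [lintegral_eq_setLIntegral_Ioo_meas_lt volume hf fun x => hf1 ▸ le_iSup f x,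
    lintegral_eq_setLIntegral_Ioo_meas_lt volume hg fun x => hg1 ▸ le_iSup g x,
    ← lintegral_const_mul _ (antitone_meas_ofReal_lt _ _).measurable,
    ← lintegral_const_mul _ (antitone_meas_ofReal_lt _ _).measurable,
    ← lintegral_add_left ((antitone_meas_ofReal_lt _ _).measurable.const_mul _)]
  refine le_trans ?_ (lintegral_mono fun x => min_le_left (h x) 1)
  rw [lintegral_eq_setLIntegral_Ioo_meas_lt volume (hh.min measurable_const)
    fun x => min_le_right _ _]
  refine setLIntegral_mono (antitone_meas_ofReal_lt _ _).measurable fun t ht => ?_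
  have ht1 : ENNReal.ofReal t < 1 := by simpa using ht.2
  have hscale : ∀ (c : ℝ), 0 < c → ∀ s : Set ℝ, ENNReal.ofReal c * volume s = volume (c • s) := by
    intro c hc s
    rw [Measure.addHaar_smul_of_nonneg _ hc.le]
    simp
  rw [hscale _ h0, hscale _ h1]
  refine MeasurableSet.volume_add_le_volume
    ((measurableSet_lt measurable_const hf).const_smul₀ _)
    ((measurableSet_lt measurable_const hg).const_smul₀ _)
    (Nonempty.smul_set (lt_iSup_iff.1 (hf1.symm ▸ ht1 : ENNReal.ofReal t < ⨆ x, f x)))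
    (Nonempty.smul_set (lt_iSup_iff.1 (hg1.symm ▸ ht1 : ENNReal.ofReal t < ⨆ x, g x))) ?_
  rintro _ ⟨_, ⟨x, hx, rfl⟩, _, ⟨y, hy, rfl⟩, rfl⟩
  refine lt_min (lt_of_lt_of_le ?_ (H x y)) ht1
  calc ENNReal.ofReal t = ENNReal.ofReal t ^ θ * ENNReal.ofReal t ^ (1 - θ) := by
        rw [← ENNReal.rpow_add_of_nonneg _ _ h0.le h1.le]; simp
    _ < f x ^ θ * g y ^ (1 - θ) :=
        ENNReal.mul_lt_mul (ENNReal.rpow_lt_rpow hx h0) (ENNReal.rpow_lt_rpow hy h1)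

theorem prekopa_leindler_real_of_iSup_ne_top {θ : ℝ} (hθ : θ ∈ Ioo (0 : ℝ) 1)
    {f g h : ℝ → ℝ≥0∞} (hf : Measurable f) (hg : Measurable g) (hh : Measurable h)
    (hfb : ⨆ x, f x ≠ ⊤) (hgb : ⨆ x, g x ≠ ⊤)
    (H : ∀ x y, f x ^ θ * g y ^ (1 - θ) ≤ h (θ * x + (1 - θ) * y)) :
    (∫⁻ x, f x) ^ θ * (∫⁻ x, g x) ^ (1 - θ) ≤ ∫⁻ x, h x := by
  have h0 : 0 < θ := hθ.1
  have h1 : 0 < 1 - θ := sub_pos.2 hθ.2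
  by_cases hf0 : ⨆ x, f x = 0
  · have : ∀ x, f x = 0 := by simpa using hf0
    simp [this, h0]
  by_cases hg0 : ⨆ x, g x = 0
  · have : ∀ x, g x = 0 := by simpa using hg0
    simp [this, hθ.2]
  set a := ⨆ x, f x with ha
  set b := ⨆ x, g x with hb
  set C := a⁻¹ ^ θ * b⁻¹ ^ (1 - θ) with hC
  have hsplit : ∀ u v : ℝ≥0∞, (a⁻¹ * u) ^ θ * (b⁻¹ * v) ^ (1 - θ) = C * (u ^ θ * v ^ (1 - θ)) := by
    intro u v
    rw [ENNReal.mul_rpow_of_nonneg _ _ h0.le, ENNReal.mul_rpow_of_nonneg _ _ h1.le, hC]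
    ring
  have hC0 : C ≠ 0 := by
    simp [hC, hfb, hgb, ENNReal.rpow_eq_zero_iff, not_lt.2 h0.le, not_lt.2 hθ.2.le]
  have hCtop : C ≠ ⊤ := ENNReal.mul_ne_top
    (ENNReal.rpow_ne_top_of_nonneg h0.le (by simpa using hf0))
    (ENNReal.rpow_ne_top_of_nonneg h1.le (by simpa using hg0))
  have key := add_lintegral_le_lintegral_of_iSup_eq_one hθ (hf.const_mul a⁻¹) (hg.const_mul b⁻¹)
    (hh.const_mul C) (by rw [← ENNReal.mul_iSup, ← ha, ENNReal.inv_mul_cancel hf0 hfb])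
    (by rw [← ENNReal.mul_iSup, ← hb, ENNReal.inv_mul_cancel hg0 hgb])
    (fun x y => by rw [hsplit]; gcongr; exact H x y)
  have key' := (ENNReal.geom_mean_le_arith_mean2_weighted hθ _ _).trans key
  rw [lintegral_const_mul _ hf, lintegral_const_mul _ hg, lintegral_const_mul _ hh, hsplit] at key'
  exact (ENNReal.mul_le_mul_iff_right hC0 hCtop).1 key'

/-- The Prékopa–Leindler inequality on the real line. -/
theorem prekopa_leindler_real {θ : ℝ} (hθ : θ ∈ Ioo (0 : ℝ) 1)
    {f g h : ℝ → ℝ≥0∞} (hf : Measurable f) (hg : Measurable g) (hh : Measurable h)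
    (H : ∀ x y, f x ^ θ * g y ^ (1 - θ) ≤ h (θ * x + (1 - θ) * y)) :
    (∫⁻ x, f x) ^ θ * (∫⁻ x, g x) ^ (1 - θ) ≤ ∫⁻ x, h x := by
  have h0 : 0 < θ := hθ.1
  have h1 : 0 < 1 - θ := sub_pos.2 hθ.2
  by_cases hf0 : ∫⁻ x, f x = 0
  · simp [hf0, h0]
  by_cases hg0 : ∫⁻ x, g x = 0
  · simp [hg0, hθ.2]
  have htrunc : ∀ {u : ℝ → ℝ≥0∞}, Measurable u → Filter.Tendsto
      (fun n : ℕ => ∫⁻ x, min (u x) n) Filter.atTop (nhds (∫⁻ x, u x)) := by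
    intro u hu
    refine lintegral_tendsto_of_tendsto_of_monotone
      (fun n => (hu.min measurable_const).aemeasurable)
      (ae_of_all _ fun x m n hmn => min_le_min_left _ (by exact_mod_cast hmn))
      (ae_of_all _ fun x => ?_)
    simpa using (tendsto_const_nhds (x := u x)).min ENNReal.tendsto_nat_nhds_top
  have hbdd : ∀ (u : ℝ → ℝ≥0∞) (n : ℕ), ⨆ x, min (u x) n ≠ ⊤ := fun u n =>
    ((iSup_le fun x => min_le_right (u x) (n : ℝ≥0∞)).trans_lt (ENNReal.natCast_lt_top n)).ne
  refine le_of_tendsto' (ENNReal.Tendsto.mul ((htrunc hf).ennrpow_const θ) (Or.inl ?_)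
    ((htrunc hg).ennrpow_const (1 - θ)) (Or.inl ?_)) fun n =>
    prekopa_leindler_real_of_iSup_ne_top hθ (hf.min measurable_const) (hg.min measurable_const) hh
      (hbdd f n) (hbdd g n) fun x y => le_trans ?_ (H x y)
  · simp [ENNReal.rpow_eq_zero_iff, hf0, not_lt.2 h0.le]
  · simp [ENNReal.rpow_eq_zero_iff, hg0, not_lt.2 hθ.2.le]
  · gcongr <;> exact min_le_left _ _

theorem lintegral_pi_fin_succ {N : ℕ} {f : (Fin (N + 1) → ℝ) → ℝ≥0∞} (hf : Measurable f) :
    ∫⁻ x, f x = ∫⁻ t, ∫⁻ y, f (Fin.cons t y) := by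
  have hmp := (volume_preserving_piFinSuccAbove (fun _ : Fin (N + 1) => ℝ) 0).symm
  rw [← hmp.lintegral_comp hf, Measure.volume_eq_prod]
  refine (lintegral_prod _ (hf.comp hmp.measurable).aemeasurable).trans ?_
  simp [MeasurableEquiv.piFinSuccAbove, Fin.consEquiv]

theorem measurable_fin_cons {N : ℕ} :
    Measurable fun p : ℝ × (Fin N → ℝ) => (Fin.cons p.1 p.2 : Fin (N + 1) → ℝ) :=
  by
  simpa [MeasurableEquiv.piFinSuccAbove] using!
    (MeasurableEquiv.piFinSuccAbove (fun _ : Fin (N + 1) => ℝ) 0).symm.measurable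

/-- The Prékopa–Leindler inequality. -/
theorem prekopa_leindler {θ : ℝ} (hθ : θ ∈ Ioo (0 : ℝ) 1) {N : ℕ}
    {f g h : (Fin N → ℝ) → ℝ≥0∞} (hf : Measurable f) (hg : Measurable g) (hh : Measurable h)
    (H : ∀ x y, f x ^ θ * g y ^ (1 - θ) ≤ h (θ • x + (1 - θ) • y)) :
    (∫⁻ x, f x) ^ θ * (∫⁻ x, g x) ^ (1 - θ) ≤ ∫⁻ x, h x := by
  induction N with
  | zero =>
    have hd : θ • (default : Fin 0 → ℝ) + (1 - θ) • default = default := Subsingleton.elim _ _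
    have hint : ∀ u : (Fin 0 → ℝ) → ℝ≥0∞, ∫⁻ x, u x = u default := fun u => by
      rw [lintegral_unique]
      simp only [volume_pi, Measure.pi_of_empty (fun _ : Fin 0 => (volume : Measure ℝ)) default,
        measure_univ, mul_one]
      exact congrArg u (Subsingleton.elim _ _)
    rw [hint, hint, hint]
    simpa only [hd] using H default default
  | succ N ih =>
    rw [lintegral_pi_fin_succ hf, lintegral_pi_fin_succ hg, lintegral_pi_fin_succ hh]
    refine prekopa_leindler_real hθ (hf.comp measurable_fin_cons).lintegral_prod_right'
      (hg.comp measurable_fin_cons).lintegral_prod_right'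
      (hh.comp measurable_fin_cons).lintegral_prod_right' fun s t => ?_
    refine ih (hf.comp (measurable_fin_cons.comp measurable_prodMk_left))
      (hg.comp (measurable_fin_cons.comp measurable_prodMk_left))
      (hh.comp (measurable_fin_cons.comp measurable_prodMk_left)) fun x y => ?_
    convert H (Fin.cons s x) (Fin.cons t y) using 2
    ext i
    refine Fin.cases ?_ (fun j => ?_) i <;> simp

theorem LogConcave.convex_pos {N : ℕ} {f : (Fin N → ℝ) → ℝ} (hf : LogConcave f) :
    Convex ℝ {x | 0 < f x} := by
  rw [convex_iff_forall_pos]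
  intro x hx y hy a b ha hb hab
  obtain rfl : b = 1 - a := by linarith
  exact (mul_pos (Real.rpow_pos_of_pos hx _) (Real.rpow_pos_of_pos hy _)).trans_le
    (hf.2 x y a ⟨ha, by linarith⟩)

theorem LogConcave.continuousOn_interior {N : ℕ} {f : (Fin N → ℝ) → ℝ} (hf : LogConcave f) :
    ContinuousOn f (interior {x | 0 < f x}) := by
  have hlog : ConcaveOn ℝ {x | 0 < f x} fun x => Real.log (f x) := by
    refine concaveOn_iff_forall_pos.2 ⟨hf.convex_pos, fun x hx y hy a b ha hb hab => ?_⟩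
    obtain rfl : b = 1 - a := by linarith
    have hx' : 0 < f x := hx
    have hy' : 0 < f y := hy
    have h := Real.log_le_log (by positivity) (hf.2 x y a ⟨ha, by linarith⟩)
    rwa [Real.log_mul (by positivity) (by positivity), Real.log_rpow hx', Real.log_rpow hy'] at h
  exact hlog.continuousOn_interior.rexp.congr fun x hx => 
    (Real.exp_log (show 0 < f x from interior_subset (s := {x | 0 < f x}) hx)).symm

/-- A log-concave function agrees almost everywhere with a Borel log-concave function. -/
theorem LogConcave.exists_measurable_ae_eq {N : ℕ} {f : (Fin N → ℝ) → ℝ} (hf : LogConcave f) :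
    ∃ f' : (Fin N → ℝ) → ℝ, LogConcave f' ∧ Measurable f' ∧ f =ᵐ[volume] f' := by
  classical
  set U := interior {x | 0 < f x} with hU
  refine ⟨U.indicator f, ⟨fun x => indicator_nonneg (fun x _ => hf.1 x) x, ?_⟩, ?_, ?_⟩
  · intro x y θ hθ
    have hnn : 0 ≤ U.indicator f (θ • x + (1 - θ) • y) := indicator_nonneg (fun x _ => hf.1 x) _
    by_cases hx : x ∈ U
    · by_cases hy : y ∈ U
      · have hxy : θ • x + (1 - θ) • y ∈ U :=
          hf.convex_pos.interior hx hy hθ.1.le (sub_pos.2 hθ.2).le (by ring)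
        rw [indicator_of_mem hx, indicator_of_mem hy, indicator_of_mem hxy]
        exact hf.2 x y θ hθ
      · rwa [indicator_of_notMem hy, Real.zero_rpow (sub_pos.2 hθ.2).ne', mul_zero]
    · rwa [indicator_of_notMem hx, Real.zero_rpow hθ.1.ne', zero_mul]
  · rw [← piecewise_eq_indicator]
    exact hf.continuousOn_interior.measurable_piecewise continuousOn_const
      isOpen_interior.measurableSet
  · have hfr : ∀ᵐ x, x ∉ frontier {x | 0 < f x} :=
      measure_eq_zero_iff_ae_notMem.1 (hf.convex_pos.addHaar_frontier volume)
    filter_upwards [hfr] with x hx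
    by_cases hxU : x ∈ U
    · rw [indicator_of_mem hxU]
    · rw [indicator_of_notMem hxU]
      by_contra hne
      exact hx ⟨subset_closure ((hf.1 x).lt_of_ne' hne), hxU⟩

theorem LogConcave.exists_le {N : ℕ} {f : (Fin N → ℝ) → ℝ} (hf : LogConcave f)
    (hfint : Integrable f) (hf0 : ∫ x, f x ≠ 0) : ∃ M, ∀ x, f x ≤ M := by
  set S := ∫⁻ x, ENNReal.ofReal (√(f x)) with hS
  have hS0 : S ≠ 0 := by
    intro h
    have hm : AEMeasurable (fun x => √(f x)) :=
      Real.continuous_sqrt.measurable.comp_aemeasurable hfint.aemeasurable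
    rw [hS, lintegral_eq_zero_iff' hm.ennreal_ofReal] at h
    refine hf0 (integral_eq_zero_of_ae ?_)
    filter_upwards [h] with x hx
    have := Real.sqrt_eq_zero'.1 (le_antisymm (ENNReal.ofReal_eq_zero.1 hx) (Real.sqrt_nonneg _))
    exact le_antisymm this (hf.1 x)
  set D := ENNReal.ofReal (|(((1 / 2 : ℝ)) ^ N)⁻¹| * ∫ x, f x) with hD
  have key : ∀ x, ENNReal.ofReal (√(f x)) * S ≤ D := by
    intro x
    have hint : Integrable fun w => f ((1 / 2 : ℝ) • x + (1 / 2 : ℝ) • w) :=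
      (hfint.comp_add_left ((1 / 2 : ℝ) • x)).comp_smul (by norm_num : (1 / 2 : ℝ) ≠ 0)
    have hval : ∫ w, f ((1 / 2 : ℝ) • x + (1 / 2 : ℝ) • w)
        = |(((1 / 2 : ℝ)) ^ N)⁻¹| * ∫ x, f x := by
      rw [Measure.integral_comp_smul volume (fun w => f ((1 / 2 : ℝ) • x + w)) (1 / 2 : ℝ),
        integral_add_left_eq_self f]
      simp
    rw [hD, ← hval, ofReal_integral_eq_lintegral_ofReal hint (ae_of_all _ fun w => hf.1 _), hS,
      ← lintegral_const_mul' _ _ ENNReal.ofReal_ne_top]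
    refine lintegral_mono fun w => ?_
    rw [← ENNReal.ofReal_mul (Real.sqrt_nonneg _)]
    refine ENNReal.ofReal_le_ofReal ?_
    have := hf.2 x w (1 / 2) ⟨by norm_num, by norm_num⟩
    rw [show (1 : ℝ) - 1 / 2 = 1 / 2 by norm_num] at this
    rwa [Real.sqrt_eq_rpow, Real.sqrt_eq_rpow]
  have hDS : D / S ≠ ⊤ := ENNReal.div_ne_top ENNReal.ofReal_ne_top hS0
  refine ⟨(D / S).toReal ^ 2, fun x => ?_⟩
  refine (Real.sqrt_le_left ENNReal.toReal_nonneg).1 ?_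
  refine (ENNReal.ofReal_le_iff_le_toReal hDS).1 ?_
  exact ENNReal.le_div_iff_mul_le (Or.inl hS0) (Or.inr ENNReal.ofReal_ne_top) |>.2 (key x)

theorem LogConcave.conv_of_measurable {N : ℕ} {f g : (Fin N → ℝ) → ℝ}
    (hf : LogConcave f) (hg : LogConcave g) (hfm : Measurable f) (hgm : Measurable g)
    (hfb : ∃ M, ∀ x, f x ≤ M) (hgint : Integrable g) :
    LogConcave (fun z => ∫ y, f (z - y) * g y) := by
  obtain ⟨M, hM⟩ := hfb
  have hnn : ∀ z y, 0 ≤ f (z - y) * g y := fun z y => mul_nonneg (hf.1 _) (hg.1 _)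
  have hm : ∀ z, Measurable fun y => f (z - y) * g y := fun z =>
    (hfm.comp (measurable_const.sub measurable_id)).mul hgm
  refine ⟨fun z => integral_nonneg (hnn z), fun z w θ hθ => ?_⟩
  have h0 : 0 < θ := hθ.1
  have h1 : 0 < 1 - θ := sub_pos.2 hθ.2
  have hfin : ∀ z, ∫⁻ y, ENNReal.ofReal (f (z - y) * g y) ≠ ⊤ := fun z => by
    refine ((hgint.bdd_mul (c := M) (hfm.comp
      (measurable_const.sub measurable_id)).aestronglyMeasurable
      (ae_of_all _ fun y => ?_)).lintegral_lt_top).ne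
    simpa [abs_of_nonneg (hf.1 _)] using hM (z - y)
  have key := prekopa_leindler hθ (hm z).ennreal_ofReal (hm w).ennreal_ofReal
    (hm (θ • z + (1 - θ) • w)).ennreal_ofReal fun x y => by
      rw [ENNReal.ofReal_rpow_of_nonneg (hnn z x) h0.le,
        ENNReal.ofReal_rpow_of_nonneg (hnn w y) h1.le,
        ← ENNReal.ofReal_mul (Real.rpow_nonneg (hnn z x) _)]
      refine ENNReal.ofReal_le_ofReal ?_
      rw [Real.mul_rpow (hf.1 _) (hg.1 _), Real.mul_rpow (hf.1 _) (hg.1 _), mul_mul_mul_comm]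
      have hsub : θ • z + (1 - θ) • w - (θ • x + (1 - θ) • y)
          = θ • (z - x) + (1 - θ) • (w - y) := by
        simp only [smul_sub]; abel
      rw [hsub]
      exact mul_le_mul (hf.2 _ _ θ hθ) (hg.2 _ _ θ hθ)
        (mul_nonneg (Real.rpow_nonneg (hg.1 _) _) (Real.rpow_nonneg (hg.1 _) _)) (hf.1 _)
  have hint : ∀ z, ∫ y, f (z - y) * g y = (∫⁻ y, ENNReal.ofReal (f (z - y) * g y)).toReal :=
    fun z => integral_eq_lintegral_of_nonneg_ae (ae_of_all _ (hnn z)) (hm z).aestronglyMeasurable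
  simp only [hint]
  rw [ENNReal.toReal_rpow, ENNReal.toReal_rpow, ← ENNReal.toReal_mul]
  exact ENNReal.toReal_mono (hfin _) key

/-- The convolution of two log-concave probability densities on `ℝ^N` is log-concave. -/
theorem logConcave_conv {N : ℕ} (f g : (Fin N → ℝ) → ℝ)
    (hf : LogConcave f) (hg : LogConcave g)
    (hfint : Integrable f) (hgint : Integrable g)
    (hfprob : ∫ x, f x = 1) (hgprob : ∫ x, g x = 1) :
    LogConcave (fun z => ∫ y, f (z - y) * g y) := by
  obtain ⟨f', hf', hfm, hff'⟩ := hf.exists_measurable_ae_eq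
  obtain ⟨g', hg', hgm, hgg'⟩ := hg.exists_measurable_ae_eq
  have hconv : (fun z => ∫ y, f (z - y) * g y) = fun z => ∫ y, f' (z - y) * g' y := by
    ext z
    refine integral_congr_ae (Filter.EventuallyEq.mul ?_ hgg')
    exact (quasiMeasurePreserving_sub_left volume z).ae_eq_comp hff'
  rw [hconv]
  refine hf'.conv_of_measurable hg' hfm hgm (hf'.exists_le (hfint.congr hff') ?_)
    (hgint.congr hgg')
  rw [← integral_congr_ae hff', hfprob]
  exact one_ne_zero
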